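/- Sylvester's theorem: every harmonic homogeneous polynomial h of degree n on ℝ³ can be written as a harmonic product of n linear forms: h(x) = (x·w₁) ∗ ... ∗ (x·wₙ) for some vectors w₁,...,wₙ ∈ ℝ³. -/

import Mathlib

open MvPolynomial

/-- The quadratic form `q(x,y,z) = x² + y² + z²`. -/
noncomputable def qForm : MvPolynomial (Fin 3) ℝ := ∑ i : Fin 3, X i ^ 2

/-- The Laplacian of a polynomial on `ℝ³`. -/
noncomputable def lap (p : MvPolynomial (Fin 3) ℝ) : MvPolynomial (Fin 3) ℝ :=
  ∑ i : Fin 3, pderiv i (pderiv i p)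

/-- A polynomial is harmonic if its Laplacian vanishes. -/
def Harmonic (p : MvPolynomial (Fin 3) ℝ) : Prop := lap p = 0

/-- `star` is a harmonic product: on harmonic polynomials, `star h₁ h₂` is the harmonic
projection `(h₁h₂)₀` of the ordinary product. -/
def IsHarmonicProduct (star : MvPolynomial (Fin 3) ℝ → MvPolynomial (Fin 3) ℝ →
    MvPolynomial (Fin 3) ℝ) : Prop :=
  ∀ h₁ h₂, Harmonic h₁ → Harmonic h₂ →
    Harmonic (star h₁ h₂) ∧ ∃ g, h₁ * h₂ - star h₁ h₂ = qForm * g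

/-- The linear form `x ↦ w · x` as a degree 1 polynomial. -/
noncomputable def linForm (w : Fin 3 → ℝ) : MvPolynomial (Fin 3) ℝ :=
  ∑ i : Fin 3, C (w i) * X i

open Matrix in
/-- If `a`, `b` are orthogonal of equal nonzero square length `R`, then `a`, `b` and their cross
product `w` resolve the identity, after rescaling. -/
lemma orthogonal_frame_resolution {a b : Fin 3 → ℝ} {R : ℝ} (hR : R ≠ 0)
    (ha : ∑ i, a i ^ 2 = R) (hb : ∑ i, b i ^ 2 = R) (hab : ∑ i, a i * b i = 0) (i j : Fin 3) :
    a i / R * a j + b i / R * b j + (a ⨯₃ b) i / R ^ 2 * (a ⨯₃ b) j = if i = j then 1 else 0 := by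
  have hw : (a ⨯₃ b) ⬝ᵥ (a ⨯₃ b) = R ^ 2 := by
    rw [cross_dot_cross]
    have h1 : a ⬝ᵥ a = R := by rw [← ha]; simp [dotProduct, sq]
    have h2 : b ⬝ᵥ b = R := by rw [← hb]; simp [dotProduct, sq]
    have h3 : a ⬝ᵥ b = 0 := hab
    rw [h1, h2, h3]; ring
  have haw := dot_self_cross a b
  have hbw := dot_cross_self a b
  have hmul : Matrix.of ![a, b, a ⨯₃ b] *
      (Matrix.of ![R⁻¹ • a, R⁻¹ • b, (R ^ 2)⁻¹ • (a ⨯₃ b)])ᵀ = 1 := by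
    generalize a ⨯₃ b = w at *
    simp only [dotProduct, Fin.sum_univ_three] at *
    ext k l
    fin_cases k <;> fin_cases l <;>
      simp [Matrix.mul_apply, Fin.sum_univ_three] <;> field_simp <;> linarith
  rw [mul_eq_one_comm] at hmul
  have h := congrFun (congrFun hmul i) j
  rw [Matrix.one_apply] at h
  rw [← h]
  simp [Matrix.mul_apply, Fin.sum_univ_three]
  ring

lemma X_eq_linForm_frame {a b : Fin 3 → ℝ} {R : ℝ} (hR : R ≠ 0)
    (ha : ∑ i, a i ^ 2 = R) (hb : ∑ i, b i ^ 2 = R) (hab : ∑ i, a i * b i = 0) (i : Fin 3) :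
    (X i : MvPolynomial (Fin 3) ℝ) = C (a i / R) * linForm a + C (b i / R) * linForm b +
      C (crossProduct a b i / R ^ 2) * linForm (crossProduct a b) := by
  have h : (X i : MvPolynomial (Fin 3) ℝ) = ∑ j, C (if i = j then 1 else 0) * X j := by
    simp [apply_ite C]
  rw [h]
  simp_rw [← orthogonal_frame_resolution hR ha hb hab, linForm, Finset.mul_sum, C_add, C_mul,
    ← Finset.sum_add_distrib]
  exact Finset.sum_congr rfl fun j _ => by ring

lemma qForm_eq_linForm_frame {a b : Fin 3 → ℝ} {R : ℝ} (hR : R ≠ 0)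
    (ha : ∑ i, a i ^ 2 = R) (hb : ∑ i, b i ^ 2 = R) (hab : ∑ i, a i * b i = 0) :
    C R * qForm = linForm a ^ 2 + linForm b ^ 2 +
      C R⁻¹ * linForm (crossProduct a b) ^ 2 := by
  have h : qForm = C R⁻¹ * linForm a ^ 2 + C R⁻¹ * linForm b ^ 2 +
      C (R ^ 2)⁻¹ * linForm (crossProduct a b) ^ 2 := by
    have h1 : ∀ i : Fin 3, (X i : MvPolynomial (Fin 3) ℝ) ^ 2 =
        C R⁻¹ * linForm a * (C (a i) * X i) + C R⁻¹ * linForm b * (C (b i) * X i) +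
        C (R ^ 2)⁻¹ * linForm (crossProduct a b) * (C (crossProduct a b i) * X i) := by
      intro i
      conv_lhs => rw [sq]
      nth_rewrite 1 [X_eq_linForm_frame hR ha hb hab i]
      simp only [div_eq_mul_inv, C_mul]
      ring
    rw [qForm, Finset.sum_congr rfl fun i _ => h1 i]
    simp only [Finset.sum_add_distrib, ← Finset.mul_sum]
    rw [← linForm, ← linForm, ← linForm]
    ring
  have e1 : (C R : MvPolynomial (Fin 3) ℝ) * C R⁻¹ = 1 := by
    rw [← C_mul, mul_inv_cancel₀ hR, C_1]
  have e2 : (C R : MvPolynomial (Fin 3) ℝ) * C (R ^ 2)⁻¹ = C R⁻¹ := by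
    rw [← C_mul]; congr 1; field_simp
  rw [h, mul_add, mul_add, ← mul_assoc, ← mul_assoc, ← mul_assoc, e1, e2]
  ring

lemma isHomogeneous_linForm (w : Fin 3 → ℝ) : (linForm w).IsHomogeneous 1 :=
  .sum _ _ _ fun i _ => isHomogeneous_C_mul_X _ i

lemma MvPolynomial.IsHomogeneous.exists_sum_X_mul {h : MvPolynomial (Fin 3) ℝ} {m : ℕ}
    (hh : h.IsHomogeneous (m + 1)) :
    ∃ f : Fin 3 → MvPolynomial (Fin 3) ℝ, (∀ i, (f i).IsHomogeneous m) ∧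
      h = ∑ i, X i * f i := by
  refine ⟨fun i => C ((m + 1 : ℝ)⁻¹) * pderiv i h, fun i => (hh.pderiv (i := i)).C_mul _, ?_⟩
  have he := hh.sum_X_mul_pderiv
  simp_rw [mul_left_comm (X _) (C _), ← Finset.mul_sum, he, nsmul_eq_mul]
  rw [← mul_assoc, ← map_natCast C, ← map_mul]
  push_cast
  rw [inv_mul_cancel₀ (by positivity), map_one, one_mul]

/-- Normal form of a homogeneous polynomial modulo the cross product form and `qForm`. -/
lemma exists_normal_form {a b : Fin 3 → ℝ} {R : ℝ} (hR : R ≠ 0)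
    (ha : ∑ i, a i ^ 2 = R) (hb : ∑ i, b i ^ 2 = R) (hab : ∑ i, a i * b i = 0) (m : ℕ)
    {h : MvPolynomial (Fin 3) ℝ} (hh : h.IsHomogeneous (m + 1)) :
    ∃ (α β : ℝ) (g r : MvPolynomial (Fin 3) ℝ), g.IsHomogeneous m ∧
      h = C α * linForm a ^ (m + 1) + C β * linForm a ^ m * linForm b +
        linForm (crossProduct a b) * g + qForm * r := by
  have split : ∀ {m : ℕ} {h : MvPolynomial (Fin 3) ℝ}, h.IsHomogeneous (m + 1) →
      ∃ f₁ f₂ f₃ : MvPolynomial (Fin 3) ℝ, f₁.IsHomogeneous m ∧ f₂.IsHomogeneous m ∧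
        f₃.IsHomogeneous m ∧
        h = linForm a * f₁ + linForm b * f₂ + linForm (crossProduct a b) * f₃ := by
    intro m h hh
    obtain ⟨f, hf, hfe⟩ := hh.exists_sum_X_mul
    refine ⟨∑ i, C (a i / R) * f i, ∑ i, C (b i / R) * f i,
      ∑ i, C (crossProduct a b i / R ^ 2) * f i,
      .sum _ _ _ fun i _ => (hf i).C_mul _, .sum _ _ _ fun i _ => (hf i).C_mul _,
      .sum _ _ _ fun i _ => (hf i).C_mul _, ?_⟩
    rw [hfe]
    simp_rw [Finset.mul_sum, ← Finset.sum_add_distrib]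
    refine Finset.sum_congr rfl fun i _ => ?_
    nth_rewrite 1 [X_eq_linForm_frame hR ha hb hab i]
    ring
  have hB : linForm b ^ 2 = C R * qForm - linForm a ^ 2 -
      C R⁻¹ * linForm (crossProduct a b) ^ 2 := by
    rw [qForm_eq_linForm_frame hR ha hb hab]; ring
  have hw := isHomogeneous_linForm (crossProduct a b)
  induction m generalizing h with
  | zero =>
    obtain ⟨f₁, f₂, f₃, h₁, h₂, h₃, rfl⟩ := split hh
    rw [← totalDegree_zero_iff_isHomogeneous, totalDegree_eq_zero_iff_eq_C] at h₁ h₂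
    refine ⟨coeff 0 f₁, coeff 0 f₂, f₃, 0, h₃, ?_⟩
    rw [← h₁, ← h₂]
    ring
  | succ m ih =>
    obtain ⟨f₁, f₂, f₃, h₁, h₂, h₃, rfl⟩ := split hh
    obtain ⟨α₁, β₁, g₁, r₁, hg₁, e₁⟩ := ih h₁
    obtain ⟨α₂, β₂, g₂, r₂, hg₂, e₂⟩ := ih h₂
    refine ⟨α₁ - β₂, β₁ + α₂, linForm a * g₁ + linForm b * g₂ + f₃ -
        C (β₂ * R⁻¹) * (linForm a ^ m * linForm (crossProduct a b)),
      linForm a * r₁ + linForm b * r₂ + C β₂ * C R * linForm a ^ m, ?_, ?_⟩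
    · refine .sub (.add (.add ?_ ?_) h₃) (.C_mul ?_ _)
      · simpa [add_comm] using (isHomogeneous_linForm a).mul hg₁
      · simpa [add_comm] using (isHomogeneous_linForm b).mul hg₂
      · simpa using ((isHomogeneous_linForm a).pow m).mul hw
    · rw [e₁, e₂]
      simp only [C_add, C_sub, C_mul]
      linear_combination C β₂ * linForm a ^ m * hB

lemma MvPolynomial.IsHomogeneous.aeval_smul_arg {σ R S : Type*} [CommSemiring R] [CommSemiring S]
    [Algebra R S] {p : MvPolynomial σ R} {n : ℕ} (hp : p.IsHomogeneous n) (c : S) (v : σ → S) :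
    MvPolynomial.aeval (c • v) p = c ^ n * MvPolynomial.aeval v p := by
  simp only [MvPolynomial.aeval_def, MvPolynomial.eval₂_eq, Finset.mul_sum, Pi.smul_apply, smul_eq_mul, mul_pow,
    Finset.prod_mul_distrib]
  refine Finset.sum_congr rfl fun d hd => ?_
  rw [Finset.prod_pow_eq_pow_sum, ← hp.degree_eq_sum_deg_support hd]
  ring

/-- A homogeneous form of positive degree vanishes somewhere on the complex isotropic cone. -/
lemma exists_isotropic_zero {h : MvPolynomial (Fin 3) ℝ} {m : ℕ} (hh : h.IsHomogeneous (m + 1)) :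
    ∃ v : Fin 3 → ℂ, v ≠ 0 ∧ ∑ i, v i ^ 2 = 0 ∧ aeval v h = 0 := by
  let P : Fin 3 → Polynomial ℂ :=
    ![1 - Polynomial.X ^ 2, Polynomial.C Complex.I * (1 + Polynomial.X ^ 2), 2 * Polynomial.X]
  let Q : Fin 3 → Polynomial ℂ :=
    ![Polynomial.X ^ 2 - 1, Polynomial.C Complex.I * (Polynomial.X ^ 2 + 1), 2 * Polynomial.X]
  have heval : ∀ (S : Fin 3 → Polynomial ℂ) (t : ℂ),
      (aeval S h).eval t = aeval (fun i => (S i).eval t) h := by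
    intro S t
    have := comp_aeval_apply S ((Polynomial.aeval t).restrictScalars ℝ) h
    simpa [Polynomial.coe_aeval_eq_eval] using this
  by_cases hdeg : (aeval P h).degree = 0
  · have hc := Polynomial.eq_C_of_degree_eq_zero hdeg
    set c := (aeval P h).coeff 0
    have hQ : aeval Q h = Polynomial.C c * Polynomial.X ^ (2 * (m + 1)) := by
      refine Polynomial.eq_of_infinite_eval_eq _ _
        ((Set.finite_singleton (0 : ℂ)).infinite_compl.mono fun s hs => ?_)
      have hs : s ≠ 0 := hs
      have hQP : (fun i => (Q i).eval s) = s ^ 2 • fun i => (P i).eval s⁻¹ := by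
        ext i
        fin_cases i <;> simp [P, Q] <;> field_simp
      have : (aeval P h).eval s⁻¹ = c := by rw [hc, Polynomial.eval_C]
      rw [Set.mem_ofPred, heval, hQP, hh.aeval_smul_arg, ← heval, this]
      simp [pow_mul, mul_comm c]
    refine ⟨fun i => (Q i).eval 0, fun h0 => ?_, ?_, ?_⟩
    · simpa [Q] using congrFun h0 0
    · simp [Q, Fin.sum_univ_three]
    · rw [← heval, hQ]
      simp
  · obtain ⟨t, ht⟩ := IsAlgClosed.exists_root _ hdeg
    refine ⟨fun i => (P i).eval t, fun h0 => ?_, ?_, ?_⟩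
    · have h1 := congrFun h0 0
      have h2 := congrFun h0 1
      simp [P] at h1 h2
      have : (2 : ℂ) = 0 := by linear_combination h1 + h2
      norm_num at this
    · simp [P, Fin.sum_univ_three, mul_pow]
      ring
    · rw [← heval]; exact ht

/-- Modulo `qForm`, a homogeneous form of positive degree has a real linear factor. -/
lemma exists_linForm_factor {h : MvPolynomial (Fin 3) ℝ} {m : ℕ} (hh : h.IsHomogeneous (m + 1)) :
    ∃ (w : Fin 3 → ℝ) (g : MvPolynomial (Fin 3) ℝ), g.IsHomogeneous m ∧
      qForm ∣ h - linForm w * g := by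
  obtain ⟨v, hv0, hvq, hvh⟩ := exists_isotropic_zero hh
  let a : Fin 3 → ℝ := fun i => (v i).re
  let b : Fin 3 → ℝ := fun i => (v i).im
  have hv : ∀ i, v i = a i + b i * Complex.I := fun i => (Complex.re_add_im _).symm
  have hre := congrArg Complex.re hvq
  have him := congrArg Complex.im hvq
  simp [Fin.sum_univ_three, sq] at hre him
  have hb : ∑ i, b i ^ 2 = ∑ i, a i ^ 2 := by
    simp only [Fin.sum_univ_three, a, b]; linarith
  have hab : ∑ i, a i * b i = 0 := by
    simp only [Fin.sum_univ_three, a, b]; linarith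
  obtain ⟨R, ha⟩ : ∃ R, ∑ i, a i ^ 2 = R := ⟨_, rfl⟩
  rw [ha] at hb
  have hR : R ≠ 0 := by
    rintro rfl
    rw [Finset.sum_eq_zero_iff_of_nonneg fun i _ => sq_nonneg _] at ha hb
    refine hv0 (funext fun i => ?_)
    have h1 := pow_eq_zero_iff (two_ne_zero) |>.mp (ha i (Finset.mem_univ i))
    have h2 := pow_eq_zero_iff (two_ne_zero) |>.mp (hb i (Finset.mem_univ i))
    rw [hv, h1, h2]; simp
  have hlin : ∀ w : Fin 3 → ℝ, aeval v (linForm w) =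
      ((∑ i, w i * a i : ℝ) : ℂ) + ((∑ i, w i * b i : ℝ) : ℂ) * Complex.I := by
    intro w
    simp only [linForm, map_sum, map_mul, aeval_X, algHom_C, Complex.coe_algebraMap, hv,
      Complex.ofReal_sum, Complex.ofReal_mul, Finset.sum_mul, ← Finset.sum_add_distrib]
    exact Finset.sum_congr rfl fun i _ => by ring
  have hA : aeval v (linForm a) = R := by
    rw [hlin, hab, ← ha]; simp [sq]
  have hB : aeval v (linForm b) = R * Complex.I := by
    rw [hlin, ← hb]
    simp_rw [mul_comm (b _) (a _), hab]
    simp [sq]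
  have hW : aeval v (linForm (crossProduct a b)) = 0 := by
    have h1 := dot_self_cross a b
    have h2 := dot_cross_self a b
    rw [dotProduct_comm] at h1 h2
    rw [dotProduct] at h1
    rw [dotProduct_comm, dotProduct] at h2
    rw [hlin, h1]
    simp_rw [mul_comm _ (b _), h2]
    simp
  have hq : aeval v qForm = 0 := by simpa [qForm] using hvq
  obtain ⟨α, β, g, r, hg, rfl⟩ := exists_normal_form hR ha hb hab m hh
  simp only [map_add, map_mul, map_pow, hA, hB, hW, hq, algHom_C, Complex.coe_algebraMap] at hvh
  have hz : (R : ℂ) ^ (m + 1) * (α + β * Complex.I) = 0 := by linear_combination hvh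
  have hz' := (mul_eq_zero.mp hz).resolve_left (pow_ne_zero _ (by exact_mod_cast hR))
  have hα : α = 0 := by simpa using congrArg Complex.re hz'
  have hβ : β = 0 := by simpa using congrArg Complex.im hz'
  exact ⟨crossProduct a b, g, hg, r, by rw [hα, hβ]; simp⟩

lemma exists_qForm_dvd_sub_prod (n : ℕ) {h : MvPolynomial (Fin 3) ℝ}
    (hh : h.IsHomogeneous (n + 1)) :
    ∃ w : Fin (n + 1) → (Fin 3 → ℝ),
      qForm ∣ h - (List.ofFn fun i => linForm (w i)).prod := by
  induction n generalizing h with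
  | zero =>
    obtain ⟨f, hf, rfl⟩ := hh.exists_sum_X_mul
    refine ⟨fun _ i => coeff 0 (f i), ?_⟩
    have hfC : ∀ i, f i = C (coeff 0 (f i)) := fun i => by
      rw [← totalDegree_eq_zero_iff_eq_C, totalDegree_zero_iff_isHomogeneous]
      exact hf i
    have : ∑ i, X i * f i = linForm fun i => coeff 0 (f i) :=
      Finset.sum_congr rfl fun i _ => by rw [mul_comm, ← hfC]
    simp [this]
  | succ n ih =>
    obtain ⟨w, g, hg, hd⟩ := exists_linForm_factor hh
    obtain ⟨u, hu⟩ := ih hg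
    refine ⟨Fin.cons w u, ?_⟩
    rw [List.ofFn_succ, List.prod_cons]
    simp only [Fin.cons_zero, Fin.cons_succ]
    convert dvd_add hd (hu.mul_left (linForm w)) using 1
    ring

/-- The Fischer pairing `p ↦ ⟨p, g⟩`, for which the monomials are orthogonal and
`x ^ d` has square length `d!`. -/
noncomputable def fischer (g : MvPolynomial (Fin 3) ℝ) : MvPolynomial (Fin 3) ℝ →ₗ[ℝ] ℝ :=
  (basisMonomials (Fin 3) ℝ).constr ℝ fun d => (∏ i, ((d i).factorial : ℝ)) * coeff d g

lemma fischer_monomial (g : MvPolynomial (Fin 3) ℝ) (d : Fin 3 →₀ ℕ) (c : ℝ) :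
    fischer g (monomial d c) = c * ((∏ i, ((d i).factorial : ℝ)) * coeff d g) := by
  have : monomial d c = c • basisMonomials (Fin 3) ℝ d := by simp [smul_monomial]
  rw [this, map_smul, fischer, Module.Basis.constr_basis, smul_eq_mul]

lemma fischer_zero : fischer 0 = 0 :=
  (basisMonomials (Fin 3) ℝ).ext fun d => by simp [fischer_monomial]

lemma fischer_X_mul (g p : MvPolynomial (Fin 3) ℝ) (i : Fin 3) :
    fischer g (X i * p) = fischer (pderiv i g) p := by
  induction p using MvPolynomial.induction_on' with
  | monomial d c =>
    rw [X, monomial_mul, one_mul, fischer_monomial, fischer_monomial, coeff_pderiv, add_comm]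
    have : ∏ j, (((d + Finsupp.single i 1 : Fin 3 →₀ ℕ) j).factorial : ℝ) =
        (d i + 1) * ∏ j, ((d j).factorial : ℝ) := by
      rw [← Finset.mul_prod_erase _ _ (Finset.mem_univ i),
        ← Finset.mul_prod_erase _ (fun j => ((d j).factorial : ℝ)) (Finset.mem_univ i)]
      have : ∏ j ∈ Finset.univ.erase i, (((d + Finsupp.single i 1 : Fin 3 →₀ ℕ) j).factorial : ℝ) =
          ∏ j ∈ Finset.univ.erase i, ((d j).factorial : ℝ) :=
        Finset.prod_congr rfl fun j hj => by
          simp [Finsupp.single_eq_of_ne (Finset.ne_of_mem_erase hj)]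
      rw [this]
      simp [Nat.factorial_succ, mul_assoc]
    rw [this]
    ring
  | add p q hp hq => rw [mul_add, map_add, map_add, hp, hq]

lemma fischer_qForm_mul (g p : MvPolynomial (Fin 3) ℝ) :
    fischer g (qForm * p) = fischer (lap g) p := by
  have hadd : ∀ s : Fin 3 → MvPolynomial (Fin 3) ℝ,
      fischer (∑ i, s i) p = ∑ i, fischer (s i) p := by
    intro s
    induction p using MvPolynomial.induction_on' with
    | monomial d c => simp_rw [fischer_monomial, coeff_sum, Finset.mul_sum]
    | add p q hp hq => simp_rw [map_add, hp, hq, Finset.sum_add_distrib]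
  rw [lap, hadd, qForm, Finset.sum_mul, map_sum]
  exact Finset.sum_congr rfl fun i _ => by rw [sq, mul_assoc, fischer_X_mul, fischer_X_mul]

lemma eq_zero_of_fischer_self {p : MvPolynomial (Fin 3) ℝ} (hp : fischer p p = 0) : p = 0 := by
  have h : fischer p p =
      ∑ d ∈ p.support, coeff d p * ((∏ i, ((d i).factorial : ℝ)) * coeff d p) := by
    conv_lhs => rw [p.as_sum, map_sum]
    exact Finset.sum_congr rfl fun d _ => by rw [← p.as_sum, fischer_monomial]
  have hfac : ∀ d : Fin 3 →₀ ℕ, 0 < ∏ i, ((d i).factorial : ℝ) := fun d =>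
    Finset.prod_pos fun i _ => by exact_mod_cast (d i).factorial_pos
  rw [h, Finset.sum_eq_zero_iff_of_nonneg fun d _ => by
    nlinarith [mul_nonneg (hfac d).le (mul_self_nonneg (coeff d p))]] at hp
  by_contra hne
  obtain ⟨d, hd⟩ := Finset.nonempty_iff_ne_empty.mpr (support_eq_empty.not.mpr hne)
  have := hp d hd
  simp [(hfac d).ne', mem_support_iff.mp hd] at this

lemma Harmonic.eq_zero_of_qForm_dvd {p : MvPolynomial (Fin 3) ℝ} (hp : Harmonic p)
    (hd : qForm ∣ p) : p = 0 := by
  obtain ⟨g, hg⟩ := hd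
  apply eq_zero_of_fischer_self
  nth_rewrite 2 [hg]
  rw [fischer_qForm_mul, hp, fischer_zero, LinearMap.zero_apply]

lemma Harmonic.sub {p q : MvPolynomial (Fin 3) ℝ} (hp : Harmonic p) (hq : Harmonic q) :
    Harmonic (p - q) := by
  have : lap (p - q) = lap p - lap q := by simp [lap, Finset.sum_sub_distrib]
  rw [Harmonic, this, hp, hq, sub_zero]

lemma harmonic_one : Harmonic 1 := by simp [Harmonic, lap]

lemma harmonic_linForm (w : Fin 3 → ℝ) : Harmonic (linForm w) := by
  refine Finset.sum_eq_zero fun i _ => ?_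
  have : pderiv i (linForm w) = C (w i) := by
    simp [linForm, pderiv_X, Pi.single_apply]
  rw [this, pderiv_C]

lemma IsHarmonicProduct.foldr {star : MvPolynomial (Fin 3) ℝ → MvPolynomial (Fin 3) ℝ →
    MvPolynomial (Fin 3) ℝ} (hstar : IsHarmonicProduct star)
    (l : List (MvPolynomial (Fin 3) ℝ)) (hl : ∀ p ∈ l, Harmonic p) :
    Harmonic (l.foldr star 1) ∧ qForm ∣ l.prod - l.foldr star 1 := by
  induction l with
  | nil => simp [harmonic_one]
  | cons p l ih =>
    obtain ⟨h₁, h₂⟩ := ih fun q hq => hl q (List.mem_cons_of_mem _ hq)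
    obtain ⟨h₃, g, hg⟩ := hstar p _ (hl p List.mem_cons_self) h₁
    refine ⟨h₃, ?_⟩
    rw [List.prod_cons, List.foldr_cons]
    convert dvd_add (h₂.mul_left p) (Dvd.intro g hg.symm) using 1
    ring

/-- **Sylvester's theorem**: every harmonic homogeneous polynomial `h` of degree `n ≥ 1`
on `ℝ³` is a harmonic product of `n` linear forms:
`h(x) = (x·w₁) ∗ ⋯ ∗ (x·wₙ)` for some vectors `w₁, …, wₙ ∈ ℝ³`. -/
theorem sylvester (star : MvPolynomial (Fin 3) ℝ → MvPolynomial (Fin 3) ℝ →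
      MvPolynomial (Fin 3) ℝ) (hstar : IsHarmonicProduct star)
    (n : ℕ) (hn : 1 ≤ n) (h : MvPolynomial (Fin 3) ℝ)
    (hharm : Harmonic h) (hhom : h.IsHomogeneous n) :
    ∃ w : Fin n → (Fin 3 → ℝ),
      h = (List.ofFn fun i => linForm (w i)).foldr star 1 := by
  obtain ⟨m, rfl⟩ : ∃ m, n = m + 1 := ⟨n - 1, by omega⟩
  obtain ⟨w, hw⟩ := exists_qForm_dvd_sub_prod m hhom
  obtain ⟨h₁, h₂⟩ := hstar.foldr (List.ofFn fun i => linForm (w i)) fun p hp => by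
    obtain ⟨i, rfl⟩ := List.mem_ofFn.mp hp
    exact harmonic_linForm _
  refine ⟨w, sub_eq_zero.mp ((hharm.sub h₁).eq_zero_of_qForm_dvd ?_)⟩
  simpa using dvd_add hw h₂
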